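/- Under the cocoercive composite setup with its range condition and with the variable metric primal–dual iteration below, there exist a solution x̄ of the primal inclusion and a solution (v̄_1,…,v̄_m) of the dual inclusion such that x_n ⇀ x̄ weakly and v_{i,n} ⇀ v̄_i weakly for every i. Iteration: set β := min{μ, ν_1,…,ν_m}; let ε ∈ (0, min{1, β}), α > 0, (λ_n) a sequence in [ε,1]; (a_n), (c_n) sequences in H with Σ‖a_n‖ < ∞, Σ‖c_n‖ < ∞; (U_n) a sequence in P_α(H) with ⟪U_{n+1}x, x⟫ ≥ ⟪U_n x, x⟫ for all n, x; for each i: v_{i,0} ∈ G_i, (b_{i,n}), (d_{i,n}) sequences in G_i with Σ‖b_{i,n}‖ < ∞, Σ‖d_{i,n}‖ < ∞, and (U_{i,n})_n in P_α(G_i) with ⟪U_{i,n+1}v, v⟫ ≥ ⟪U_{i,n}v, v⟫ for all n, v. For each n let R_n be the bounded self-adjoint operator with ⟪R_n x, x⟫ ≥ 0 for all x and R_n ∘ R_n = U_n, and similarly S_{i,n} with S_{i,n} ∘ S_{i,n} = U_{i,n}; set δ_n := (Σ_{i=1}^m ‖S_{i,n} ∘ L_i ∘ R_n‖²)^{−1/2}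 − 1 and assume δ_n/((1+δ_n)·max{‖U_n‖, ‖U_{1,n}‖, …, ‖U_{m,n}‖}) ≥ 1/(2β−ε). The sequences satisfy, for every n: p_n = π_n + a_n where π_n is the point with (x_n − U_n(Σ_i L_i* v_{i,n} + C x_n + c_n − z)) − π_n ∈ {U_n u : u ∈ A π_n}; y_n = 2p_n − x_n; x_{n+1} = x_n + λ_n(p_n − x_n); for each i: t_{i,n} is a point with v_{i,n} ∈ D_i t_{i,n}; q_{i,n} = κ_{i,n} + b_{i,n} where κ_{i,n} satisfies: there exists u with κ_{i,n} ∈ B_i u and (v_{i,n} + U_{i,n}(L_i y_n − t_{i,n} − d_{i,n} − r_i)) − κ_{i,n} = U_{i,n} u; and v_{i,n+1} = v_{i,n} + λ_n(q_{i,n} − v_{i,n}). -/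

import Mathlib

open RealInnerProductSpace Filter Topology

/-- A monotone relation whose graph contains every pair monotonically related to it. -/
def IsMaxMonotone {E : Type*} [NormedAddCommGroup E] [InnerProductSpace ℝ E]
    (T : E → E → Prop) : Prop :=
  (∀ x y u v, T x u → T y v → 0 ≤ ⟪x - y, u - v⟫) ∧
    ∀ y v, (∀ x u, T x u → 0 ≤ ⟪x - y, u - v⟫) → T y v

section Hilbert

variable {E : Type*} [NormedAddCommGroup E] [InnerProductSpace ℝ E]

theorem exists_weak_limit_along_ultrafilter [CompleteSpace E] {w : ℕ → E} {B : ℝ}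
    (hw : ∀ n, ‖w n‖ ≤ B) (F : Ultrafilter ℕ) :
    ∃ x, ∀ y, Tendsto (fun n => ⟪w n, y⟫) F (𝓝 ⟪x, y⟫) := by
  have hin : ∀ n, InnerProductSpace.toDual ℝ E (w n) ∈ Metric.closedBall 0 B := by
    intro n
    simpa using hw n
  obtain ⟨φ, -, hφ⟩ :=
    (WeakDual.isCompact_closedBall (𝕜 := ℝ) (0 : StrongDual ℝ E) B).ultrafilter_le_nhds
    (F.map fun n => (StrongDual.toWeakDual (InnerProductSpace.toDual ℝ E (w n))))
    (by
      rw [le_principal_iff]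
      exact Filter.mem_map.2 (Filter.univ_mem' hin))
  refine ⟨(InnerProductSpace.toDual ℝ E).symm (WeakDual.toStrongDual φ), fun y => ?_⟩
  have h2 := ((WeakDual.eval_continuous (𝕜 := ℝ) y).tendsto φ).comp (show Tendsto _ _ _ from hφ)
  rw [InnerProductSpace.toDual_symm_apply]
  exact h2

theorem tendsto_inner_of_weak_of_strong {l : Filter ℕ} {w u : ℕ → E} {x a : E} {B : ℝ}
    (hB : ∀ n, ‖w n‖ ≤ B) (hw : ∀ y, Tendsto (fun n => ⟪w n, y⟫) l (𝓝 ⟪x, y⟫))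
    (hu : Tendsto u l (𝓝 a)) : Tendsto (fun n => ⟪w n, u n⟫) l (𝓝 ⟪x, a⟫) := by
  have h0 : Tendsto (fun n => ⟪w n, u n - a⟫) l (𝓝 0) := by
    have h1 : Tendsto (fun n => B * ‖u n - a‖) l (𝓝 0) := by
      simpa using (tendsto_iff_norm_sub_tendsto_zero.1 hu).const_mul B
    refine squeeze_zero_norm (fun n => ?_) h1
    exact (norm_inner_le_norm _ _).trans (by gcongr; exact hB n)
  have h2 := h0.add (hw a)
  simp only [inner_sub_right, sub_add_cancel, zero_add] at h2
  exact h2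

theorem norm_sq_apply_le_of_inner_le {P : E →L[ℝ] E} (hs : ∀ u v, ⟪P u, v⟫ = ⟪u, P v⟫)
    (h0 : ∀ u, 0 ≤ ⟪P u, u⟫) {c : ℝ} (hc : 0 < c) (hle : ∀ u, ⟪P u, u⟫ ≤ c * ‖u‖ ^ 2) (u : E) :
    ‖P u‖ ^ 2 ≤ c * ⟪P u, u⟫ := by
  have h1 := h0 (u - c⁻¹ • P u)
  have h2 := hle (P u)
  have h3 : ⟪P (P u), u⟫ = ‖P u‖ ^ 2 := by rw [hs, real_inner_self_eq_norm_sq]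
  simp only [map_sub, map_smul, inner_sub_left, inner_sub_right, real_inner_smul_left,
    real_inner_smul_right, h3, real_inner_self_eq_norm_sq] at h1
  have h4 : c⁻¹ * (c⁻¹ * ⟪P (P u), P u⟫) ≤ c⁻¹ * ‖P u‖ ^ 2 := by
    calc c⁻¹ * (c⁻¹ * ⟪P (P u), P u⟫) ≤ c⁻¹ * (c⁻¹ * (c * ‖P u‖ ^ 2)) := by gcongr
      _ = _ := by field_simp
  have h5 : c⁻¹ * ‖P u‖ ^ 2 ≤ ⟪P u, u⟫ := by linarith
  calc ‖P u‖ ^ 2 = c * (c⁻¹ * ‖P u‖ ^ 2) := by field_simp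
    _ ≤ _ := by gcongr

theorem exists_tendsto_of_antitone_inner [CompleteSpace E] {M : ℕ → E →L[ℝ] E}
    (hs : ∀ n u v, ⟪M n u, v⟫ = ⟪u, M n v⟫) (h0 : ∀ n u, 0 ≤ ⟪M n u, u⟫)
    (hanti : ∀ u, Antitone fun n => ⟪M n u, u⟫) (u : E) :
    ∃ a, Tendsto (fun n => M n u) atTop (𝓝 a) := by
  have hc : 0 < ‖M 0‖ + 1 := by positivity
  have hle0 : ∀ u, ⟪M 0 u, u⟫ ≤ (‖M 0‖ + 1) * ‖u‖ ^ 2 := fun u => by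
    have h1 := real_inner_le_norm (M 0 u) u
    have h2 := (M 0).le_opNorm u
    nlinarith [norm_nonneg u, sq_nonneg ‖u‖]
  have hbdd : BddBelow (Set.range fun n => ⟪M n u, u⟫) := ⟨0, by rintro _ ⟨n, rfl⟩; exact h0 n u⟩
  have hlim := tendsto_atTop_ciInf (hanti u) hbdd
  have hge : ∀ n, (⨅ n, ⟪M n u, u⟫) ≤ ⟪M n u, u⟫ := fun n => ciInf_le hbdd n
  refine cauchySeq_tendsto_of_complete (Metric.cauchySeq_iff'.2 fun η hη => ?_)
  have hpos : 0 < η ^ 2 / (‖M 0‖ + 1) := by positivity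
  obtain ⟨N, hN⟩ := ((tendsto_order.1 hlim).2 _ (lt_add_of_pos_right _ hpos)).exists
  refine ⟨N, fun n hn => ?_⟩
  have key := norm_sq_apply_le_of_inner_le (P := M N - M n)
    (fun a b => by simp [inner_sub_left, inner_sub_right, hs])
    (fun a => by
      have := hanti a hn
      simpa [inner_sub_left] using this) hc
    (fun a => by
      have h1 := hanti a (Nat.zero_le N)
      have h2 := hle0 a
      have h3 := h0 n a
      simp only [sub_apply, inner_sub_left] at h1 ⊢
      linarith) u
  simp only [sub_apply, inner_sub_left] at key
  rw [dist_comm, dist_eq_norm]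
  refine lt_of_pow_lt_pow_left₀ 2 hη.le (key.trans_lt ?_)
  calc (‖M 0‖ + 1) * (⟪M N u, u⟫ - ⟪M n u, u⟫) < (‖M 0‖ + 1) * (η ^ 2 / (‖M 0‖ + 1)) := by
        gcongr
        linarith [hge n]
    _ = η ^ 2 := by field_simp

theorem inner_apply_sq_le {P : E →L[ℝ] E} (hs : ∀ u v, ⟪P u, v⟫ = ⟪u, P v⟫)
    (h0 : ∀ u, 0 ≤ ⟪P u, u⟫) (u v : E) : ⟪P u, v⟫ ^ 2 ≤ ⟪P u, u⟫ * ⟪P v, v⟫ := by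
  have h : ∀ t : ℝ, 0 ≤ ⟪P v, v⟫ * (t * t) + 2 * ⟪P u, v⟫ * t + ⟪P u, u⟫ := fun t => by
    have h1 := h0 (u + t • v)
    have h2 : ⟪P v, u⟫ = ⟪P u, v⟫ := by rw [hs, real_inner_comm]
    simp only [map_add, map_smul, inner_add_left, inner_add_right, real_inner_smul_left,
      real_inner_smul_right, h2] at h1
    linarith
  have := discrim_le_zero h
  unfold discrim at this
  nlinarith

theorem sqrt_inner_add_le {P : E →L[ℝ] E} (hs : ∀ u v, ⟪P u, v⟫ = ⟪u, P v⟫)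
    (h0 : ∀ u, 0 ≤ ⟪P u, u⟫) (u v : E) :
    √⟪P (u + v), u + v⟫ ≤ √⟪P u, u⟫ + √⟪P v, v⟫ := by
  rw [Real.sqrt_le_left (by positivity)]
  have h1 : ⟪P u, v⟫ ≤ √⟪P u, u⟫ * √⟪P v, v⟫ := by
    rw [← Real.sqrt_mul (h0 u)]
    exact Real.le_sqrt_of_sq_le (inner_apply_sq_le hs h0 u v)
  have h2 : ⟪P v, u⟫ = ⟪P u, v⟫ := by rw [hs, real_inner_comm]
  rw [add_sq, Real.sq_sqrt (h0 u), Real.sq_sqrt (h0 v)]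
  simp only [map_add, inner_add_left, inner_add_right, h2]
  linarith

theorem sqrt_inner_smul {P : E →L[ℝ] E} {t : ℝ} (ht : 0 ≤ t) (u : E) :
    √⟪P (t • u), t • u⟫ = t * √⟪P u, u⟫ := by
  rw [map_smul, real_inner_smul_left, real_inner_smul_right, ← mul_assoc,
    Real.sqrt_mul (mul_self_nonneg t), Real.sqrt_mul_self ht]

end Hilbert

theorem tendsto_of_le_add_summable {Y η : ℕ → ℝ} (hY : ∀ n, 0 ≤ Y n) (hη0 : ∀ n, 0 ≤ η n)
    (hη : Summable η) (h : ∀ n, Y (n + 1) ≤ Y n + η n) : ∃ l, Tendsto Y atTop (𝓝 l) := by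
  have hanti : Antitone fun n => Y n - ∑ k ∈ Finset.range n, η k :=
    antitone_nat_of_succ_le fun n => by
      rw [Finset.sum_range_succ]
      linarith [h n]
  have hbdd : BddBelow (Set.range fun n => Y n - ∑ k ∈ Finset.range n, η k) :=
    ⟨-∑' k, η k, by
      rintro _ ⟨n, rfl⟩
      have := hη.sum_le_tsum (Finset.range n) fun k _ => hη0 k
      simp only
      linarith [hY n]⟩
  have h1 := (tendsto_atTop_ciInf hanti hbdd).add hη.hasSum.tendsto_sum_nat
  simp only [sub_add_cancel] at h1
  exact ⟨_, h1⟩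

section VariableMetric

variable {E : Type*} [NormedAddCommGroup E] [InnerProductSpace ℝ E]

/-- Scalar estimates for a relaxed step with errors `h` and `k`. -/
theorem relaxed_step_estimate {X Y Y' h k lam ε Δ : ℝ} (hX0 : 0 ≤ X) (hY0 : 0 ≤ Y)
    (hY'0 : 0 ≤ Y') (hh0 : 0 ≤ h) (hk0 : 0 ≤ k) (hΔ0 : 0 ≤ Δ) (hε : 0 < ε)
    (hlam : lam ∈ Set.Icc ε 1) (hstep : X ^ 2 ≤ Y ^ 2 - Δ + h * X)
    (hY'W : Y' ≤ (1 - lam) * Y + lam * X + lam * k) :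
    Y' ≤ Y + (h + k) ∧ ε * Δ ≤ Y ^ 2 - Y' ^ 2 + 3 * (h + k) * (Y + (h + k)) := by
  obtain ⟨hl1, hl2⟩ := hlam
  have hl0 : 0 ≤ lam := hε.le.trans hl1
  have hl3 : 0 ≤ 1 - lam := sub_nonneg.2 hl2
  have hXY : X ≤ Y + h := by
    by_contra! hlt
    nlinarith
  set W := (1 - lam) * Y + lam * X with hW
  have hW0 : 0 ≤ W := by positivity
  have hWY : W ≤ Y + h := by nlinarith
  have hlk : lam * k ≤ k := mul_le_of_le_one_left hk0 hl2
  have hW2 : W ^ 2 ≤ (1 - lam) * Y ^ 2 + lam * X ^ 2 := by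
    have : (1 - lam) * Y ^ 2 + lam * X ^ 2 - W ^ 2 = lam * (1 - lam) * (Y - X) ^ 2 := by
      rw [hW]; ring
    nlinarith [mul_nonneg (mul_nonneg hl0 (hl3)) (sq_nonneg (Y - X))]
  have hW2' : W ^ 2 ≤ Y ^ 2 - ε * Δ + h * (Y + h) := by
    have h1 : lam * X ^ 2 ≤ lam * (Y ^ 2 - Δ + h * X) := by gcongr
    have h2 : ε * Δ ≤ lam * Δ := by gcongr
    have h3 : lam * (h * X) ≤ h * (Y + h) :=
      (mul_le_of_le_one_left (by positivity) hl2).trans (by gcongr)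
    linarith
  have hY'2 : Y' ^ 2 ≤ (W + k) ^ 2 := by gcongr; linarith
  refine ⟨by linarith, ?_⟩
  have h1 := mul_le_mul_of_nonneg_left hWY hk0
  have h2 : 0 ≤ 2 * (h * Y) + k * Y + 2 * h ^ 2 + 4 * (h * k) + 2 * k ^ 2 := by positivity
  linarith

/-- One exact forward-backward step in the metric of `P`. -/
theorem forward_backward_sq_le {P : E →L[ℝ] E} (hs : ∀ u v, ⟪P u, v⟫ = ⟪u, P v⟫)
    {ρ β : ℝ} (hρ : 0 < ρ) (hβ : 0 < β)
    (hP : ∀ u, ρ * ‖u‖ ^ 2 ≤ ⟪P u, u⟫) {w s g e wb gb : E}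
    (hmono : 0 ≤ ⟪s - wb, P (w - s) - g - e + gb⟫)
    (hcoc : β * ‖g - gb‖ ^ 2 ≤ ⟪w - wb, g - gb⟫) :
    ⟪P (s - wb), s - wb⟫ ≤ ⟪P (w - wb), w - wb⟫
      - (2 * β * ρ - 1) / (ρ + 2 * β) * (‖w - s‖ ^ 2 + ‖g - gb‖ ^ 2)
      + 2 * (‖s - wb‖ * ‖e‖) := by
  have h1 : ⟪P (w - wb), w - wb⟫ =
      ⟪P (w - s), w - s⟫ + 2 * ⟪P (w - s), s - wb⟫ + ⟪P (s - wb), s - wb⟫ := by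
    have h2 : ⟪P (s - wb), w - s⟫ = ⟪P (w - s), s - wb⟫ := by rw [hs, real_inner_comm]
    rw [← sub_add_sub_cancel w s wb]
    simp only [map_add, inner_add_left, inner_add_right, h2]
    ring
  have h3 : ⟪s - wb, P (w - s) - g - e + gb⟫ =
      ⟪P (w - s), s - wb⟫ - ⟪w - wb, g - gb⟫ + ⟪w - s, g - gb⟫ - ⟪s - wb, e⟫ := by
    rw [real_inner_comm (s - wb)]
    simp only [inner_sub_left, inner_sub_right, inner_add_right]
    ring
  have h4 := real_inner_le_norm (w - s) (g - gb)
  have h5 := (abs_le.1 (abs_real_inner_le_norm (s - wb) e)).1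
  have h6 := hP (w - s)
  have hquad : ∀ x y : ℝ, (2 * β * ρ - 1) / (ρ + 2 * β) * (x ^ 2 + y ^ 2)
      ≤ ρ * x ^ 2 - 2 * (x * y) + 2 * β * y ^ 2 := fun x y => by
    rw [div_mul_eq_mul_div, div_le_iff₀ (by positivity)]
    have : (ρ * x ^ 2 - 2 * (x * y) + 2 * β * y ^ 2) * (ρ + 2 * β)
        - (2 * β * ρ - 1) * (x ^ 2 + y ^ 2) = (ρ * x - y) ^ 2 + (2 * β * y - x) ^ 2 := by ring
    linarith [sq_nonneg (ρ * x - y), sq_nonneg (2 * β * y - x)]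
  have h7 := hquad ‖w - s‖ ‖g - gb‖
  linarith

theorem forward_backward_step {P P' : E →L[ℝ] E} (hs : ∀ u v, ⟪P u, v⟫ = ⟪u, P v⟫)
    {ρ β C lam ε : ℝ} (hρ : 0 < ρ) (hβ : 0 < β) (hβρ : 1 < 2 * β * ρ)
    (hP : ∀ u, ρ * ‖u‖ ^ 2 ≤ ⟪P u, u⟫) (hPC : ∀ u, ⟪P u, u⟫ ≤ C * ‖u‖ ^ 2)
    (hPP' : ∀ u, ⟪P' u, u⟫ ≤ ⟪P u, u⟫) (hε : 0 < ε) (hlam : lam ∈ Set.Icc ε 1)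
    {w s g e f wb gb : E}
    (hmono : 0 ≤ ⟪s - wb, P (w - s) - g - e + gb⟫)
    (hcoc : β * ‖g - gb‖ ^ 2 ≤ ⟪w - wb, g - gb⟫) {Y Y' η : ℝ}
    (hY : Y = √⟪P (w - wb), w - wb⟫)
    (hY' : Y' = √⟪P' (w + lam • (s + f - w) - wb), w + lam • (s + f - w) - wb⟫)
    (hη : η = 2 / √ρ * ‖e‖ + √C * ‖f‖) :
    Y' ≤ Y + η ∧ ε * ((2 * β * ρ - 1) / (ρ + 2 * β)) * (‖w - s‖ ^ 2 + ‖g - gb‖ ^ 2)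
      ≤ Y ^ 2 - Y' ^ 2 + 3 * η * (Y + η) := by
  have h0 : ∀ u, 0 ≤ ⟪P u, u⟫ := fun u => le_trans (by positivity) (hP u)
  have hmain := forward_backward_sq_le hs hρ hβ hP hmono hcoc
  set Δ := (2 * β * ρ - 1) / (ρ + 2 * β) * (‖w - s‖ ^ 2 + ‖g - gb‖ ^ 2) with hΔ
  have hΔ0 : 0 ≤ Δ := mul_nonneg (div_nonneg (by linarith) (by positivity)) (by positivity)
  obtain ⟨hl1, hl2⟩ := hlam
  have hl0 : 0 ≤ lam := hε.le.trans hl1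
  set X := √⟪P (s - wb), s - wb⟫ with hX
  set k := √C * ‖f‖ with hk
  set h := 2 / √ρ * ‖e‖ with hh
  have hX0 : 0 ≤ X := Real.sqrt_nonneg _
  have hY0 : 0 ≤ Y := hY ▸ Real.sqrt_nonneg _
  have hY'0 : 0 ≤ Y' := hY' ▸ Real.sqrt_nonneg _
  have hk0 : 0 ≤ k := by positivity
  have hh0 : 0 ≤ h := by positivity
  have hX2 : X ^ 2 = ⟪P (s - wb), s - wb⟫ := Real.sq_sqrt (h0 _)
  have hY2 : Y ^ 2 = ⟪P (w - wb), w - wb⟫ := by rw [hY, Real.sq_sqrt (h0 _)]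
  have hnorm : √ρ * ‖s - wb‖ ≤ X := by
    refine Real.le_sqrt_of_sq_le ?_
    rw [mul_pow, Real.sq_sqrt hρ.le]
    exact hP _
  have herr : 2 * (‖s - wb‖ * ‖e‖) ≤ h * X := by
    have hσ : 0 < √ρ := Real.sqrt_pos.2 hρ
    calc 2 * (‖s - wb‖ * ‖e‖) = 2 / √ρ * ‖e‖ * (√ρ * ‖s - wb‖) := by field_simp
      _ ≤ _ := by gcongr
  have hstep : X ^ 2 ≤ Y ^ 2 - Δ + h * X := by rw [hX2, hY2]; linarith
  have hf : √⟪P f, f⟫ ≤ k := by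
    rw [hk, ← Real.sqrt_sq (norm_nonneg f), ← Real.sqrt_mul' _ (sq_nonneg _)]
    exact Real.sqrt_le_sqrt (hPC f)
  have hY'W : Y' ≤ (1 - lam) * Y + lam * X + lam * k := by
    have hdec : w + lam • (s + f - w) - wb
        = (1 - lam) • (w - wb) + lam • (s - wb) + lam • f := by module
    calc Y' ≤ √⟪P (w + lam • (s + f - w) - wb), w + lam • (s + f - w) - wb⟫ :=
          hY' ▸ Real.sqrt_le_sqrt (hPP' _)
      _ ≤ (1 - lam) * Y + lam * X + lam * √⟪P f, f⟫ := by
          rw [hdec, hY, hX, ← sqrt_inner_smul hl0, ← sqrt_inner_smul hl0,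
            ← sqrt_inner_smul (sub_nonneg.2 hl2)]
          exact (sqrt_inner_add_le hs h0 _ _).trans
            (by gcongr; exact sqrt_inner_add_le hs h0 _ _)
      _ ≤ _ := by gcongr
  rw [hη, mul_assoc, ← hΔ]
  exact relaxed_step_estimate hX0 hY0 hY'0 hh0 hk0 hΔ0 hε ⟨hl1, hl2⟩ hstep hY'W

/-- Weak convergence of the inexact variable metric forward-backward iteration for
`0 ∈ T x + N x + Q x` with `T` maximally monotone, `N` linear and skew, and `Q` cocoercive. -/
theorem variable_metric_forward_backward [CompleteSpace E] {T Q : E → E → Prop}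
    (hT : IsMaxMonotone T) (hQ : IsMaxMonotone Q) {β : ℝ} (hβ : 0 < β)
    (hcoc : ∀ x y u v, Q x u → Q y v → β * ‖u - v‖ ^ 2 ≤ ⟪x - y, u - v⟫)
    {N : E →ₗ[ℝ] E} (hN : ∀ u v, ⟪N u, v⟫ = -⟪u, N v⟫)
    {M : ℕ → E →L[ℝ] E} (hs : ∀ n u v, ⟪M n u, v⟫ = ⟪u, M n v⟫)
    (hanti : ∀ n u, ⟪M (n + 1) u, u⟫ ≤ ⟪M n u, u⟫)
    {ρ : ℝ} (hρ : 0 < ρ) (hβρ : 1 < 2 * β * ρ) (hM : ∀ n u, ρ * ‖u‖ ^ 2 ≤ ⟪M n u, u⟫)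
    {lam : ℕ → ℝ} {ε : ℝ} (hε : 0 < ε) (hlam : ∀ n, lam n ∈ Set.Icc ε 1)
    {w s g e f : ℕ → E} (he : Summable fun n => ‖e n‖) (hf : Summable fun n => ‖f n‖)
    (hTs : ∀ n, T (s n) (M n (w n - s n) - g n - e n - N (s n)))
    (hQw : ∀ n, Q (w n) (g n)) (hw : ∀ n, w (n + 1) = w n + lam n • (s n + f n - w n))
    (hsol : ∃ x u, Q x u ∧ T x (-u - N x)) :
    ∃ x u, Q x u ∧ T x (-u - N x) ∧
      ∀ y, Tendsto (fun n => ⟪w n, y⟫) atTop (𝓝 ⟪x, y⟫) := by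
  have h0 : ∀ n u, 0 ≤ ⟪M n u, u⟫ := fun n u => le_trans (by positivity) (hM n u)
  have hantitone : ∀ u, Antitone fun n => ⟪M n u, u⟫ := fun u =>
    antitone_nat_of_succ_le fun n => hanti n u
  set C := ‖M 0‖ + 1 with hC
  have hC0 : 0 < C := by positivity
  have hMC : ∀ n u, ⟪M n u, u⟫ ≤ C * ‖u‖ ^ 2 := fun n u => by
    have h1 := real_inner_le_norm (M 0 u) u
    have h2 := (M 0).le_opNorm u
    have h3 := hantitone u (Nat.zero_le n)
    simp only at h3
    nlinarith [norm_nonneg u, sq_nonneg ‖u‖]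
  have hskew : ∀ u, ⟪u, N u⟫ = 0 := fun u => by
    have := hN u u
    rw [real_inner_comm] at this
    linarith
  set η : ℕ → ℝ := fun n => 2 / √ρ * ‖e n‖ + √C * ‖f n‖ with hη
  have hηs : Summable η := (he.mul_left _).add (hf.mul_left _)
  have hη0 : ∀ n, 0 ≤ η n := fun n => by positivity
  have hηlim := hηs.tendsto_atTop_zero
  -- Quasi-Fejer monotonicity with respect to every solution.
  have hstep : ∀ x u, Q x u → T x (-u - N x) → ∀ n,
      √⟪M (n + 1) (w (n + 1) - x), w (n + 1) - x⟫ ≤ √⟪M n (w n - x), w n - x⟫ + η n ∧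
      ε * ((2 * β * ρ - 1) / (ρ + 2 * β)) * (‖w n - s n‖ ^ 2 + ‖g n - u‖ ^ 2) ≤
        √⟪M n (w n - x), w n - x⟫ ^ 2 - √⟪M (n + 1) (w (n + 1) - x), w (n + 1) - x⟫ ^ 2
          + 3 * η n * (√⟪M n (w n - x), w n - x⟫ + η n) := by
    intro x u hx hTx n
    refine forward_backward_step (hs n) (P' := M (n + 1)) hρ hβ hβρ (hM n) (hMC n) (hanti n) hε
      (hlam n) (f := f n) ?_ (hcoc _ _ _ _ (hQw n) hx) rfl (by rw [hw n]) rfl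
    have h1 := hT.1 _ _ _ _ (hTs n) hTx
    have h2 : M n (w n - s n) - g n - e n - N (s n) - (-u - N x)
        = M n (w n - s n) - g n - e n + u - N (s n - x) := by
      rw [map_sub N]; abel
    rwa [h2, inner_sub_right, hskew, sub_zero] at h1
  have hYlim : ∀ x u, Q x u → T x (-u - N x) →
      ∃ l, Tendsto (fun n => √⟪M n (w n - x), w n - x⟫) atTop (𝓝 l) := fun x u hx hTx =>
    tendsto_of_le_add_summable (fun n => Real.sqrt_nonneg _) hη0 hηs
      fun n => (hstep x u hx hTx n).1
  obtain ⟨x₀, u₀, hx₀, hTx₀⟩ := hsol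
  obtain ⟨l₀, hl₀⟩ := hYlim x₀ u₀ hx₀ hTx₀
  have hgap : Tendsto (fun n => ‖w n - s n‖ ^ 2 + ‖g n - u₀‖ ^ 2) atTop (𝓝 0) := by
    set c := ε * ((2 * β * ρ - 1) / (ρ + 2 * β)) with hc
    have hc0 : 0 < c := mul_pos hε (div_pos (by linarith) (by positivity))
    have h1 := ((hl₀.pow 2).sub ((hl₀.comp (tendsto_add_atTop_nat 1)).pow 2)).add
      ((hηlim.const_mul 3).mul (hl₀.add hηlim))
    have h2 := h1.const_mul c⁻¹
    simp only [sub_self, mul_zero, zero_mul, add_zero] at h2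
    refine squeeze_zero (fun n => by positivity) (fun n => ?_) h2
    have h3 := (hstep x₀ u₀ hx₀ hTx₀ n).2
    rw [inv_mul_eq_div, le_div_iff₀ hc0, mul_comm]
    exact h3
  have hsq : ∀ {b : ℕ → E}, (∀ n, ‖b n‖ ^ 2 ≤ ‖w n - s n‖ ^ 2 + ‖g n - u₀‖ ^ 2) →
      Tendsto b atTop (𝓝 0) := fun {b} hb => by
    rw [tendsto_zero_iff_norm_tendsto_zero]
    have h1 := (squeeze_zero (fun n => by positivity) hb hgap).sqrt
    simpa [Real.sqrt_sq] using h1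
  have hws : Tendsto (fun n => w n - s n) atTop (𝓝 0) := hsq fun n => by
    linarith [sq_nonneg ‖g n - u₀‖]
  have hg : Tendsto g atTop (𝓝 u₀) := tendsto_sub_nhds_zero_iff.1 <| hsq fun n => by
    linarith [sq_nonneg ‖w n - s n‖]
  have hMws : Tendsto (fun n => M n (w n - s n)) atTop (𝓝 0) := by
    rw [tendsto_zero_iff_norm_tendsto_zero]
    have h1 := (tendsto_zero_iff_norm_tendsto_zero.1 hws).const_mul C
    rw [mul_zero] at h1
    refine squeeze_zero (fun n => norm_nonneg _) (fun n => ?_) h1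
    refine le_of_sq_le_sq ?_ (by positivity)
    have h2 := norm_sq_apply_le_of_inner_le (hs n) (h0 n) hC0 (hMC n) (w n - s n)
    have h3 := mul_le_mul_of_nonneg_left (hMC n (w n - s n)) hC0.le
    nlinarith
  have he0 : Tendsto e atTop (𝓝 0) := tendsto_zero_iff_norm_tendsto_zero.2 he.tendsto_atTop_zero
  have hout : Tendsto (fun n => M n (w n - s n) - g n - e n) atTop (𝓝 (-u₀)) := by
    simpa using (hMws.sub hg).sub he0
  obtain ⟨B, hB⟩ : ∃ B, ∀ n, ‖w n‖ ≤ B := by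
    obtain ⟨B, hB⟩ := hl₀.bddAbove_range
    refine ⟨B / √ρ + ‖x₀‖, fun n => ?_⟩
    have h1 : √ρ * ‖w n - x₀‖ ≤ B := by
      refine le_trans (Real.le_sqrt_of_sq_le ?_) (hB ⟨n, rfl⟩)
      rw [mul_pow, Real.sq_sqrt hρ.le]
      exact hM n _
    have h2 : ‖w n - x₀‖ ≤ B / √ρ := by
      rw [le_div_iff₀ (Real.sqrt_pos.2 hρ), mul_comm]
      exact h1
    linarith [norm_le_norm_sub_add (w n) x₀]
  obtain ⟨B', hB'⟩ : ∃ B', ∀ n, ‖s n‖ ≤ B' := by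
    obtain ⟨B₁, hB₁⟩ := (tendsto_zero_iff_norm_tendsto_zero.1 hws).bddAbove_range
    refine ⟨B + B₁, fun n => ?_⟩
    have h1 : ‖w n - s n‖ ≤ B₁ := hB₁ ⟨n, rfl⟩
    have h2 := norm_sub_le (w n) (w n - s n)
    rw [sub_sub_cancel] at h2
    linarith [hB n]
  -- Every weak cluster point is a solution.
  have hcluster : ∀ (F : Ultrafilter ℕ) x, ↑F ≤ (atTop : Filter ℕ) →
      (∀ y, Tendsto (fun n => ⟪w n, y⟫) F (𝓝 ⟪x, y⟫)) → Q x u₀ ∧ T x (-u₀ - N x) := by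
    intro F x hF hx
    have hsx : ∀ y, Tendsto (fun n => ⟪s n, y⟫) F (𝓝 ⟪x, y⟫) := fun y => by
      have h1 := (hx y).sub ((hws.mono_left hF).inner tendsto_const_nhds (𝕜 := ℝ) (y := y))
      simpa [← inner_sub_left] using h1
    have hB1 : ∀ y n, ‖w n - y‖ ≤ B + ‖y‖ := fun y n =>
      (norm_sub_le _ _).trans (by gcongr; exact hB n)
    have hB2 : ∀ y n, ‖s n - y‖ ≤ B' + ‖y‖ := fun y n =>
      (norm_sub_le _ _).trans (by gcongr; exact hB' n)
    refine ⟨hQ.2 _ _ fun y v hyv => ?_, hT.2 _ _ fun y v hyv => ?_⟩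
    · have h1 : Tendsto (fun n => ⟪w n - y, g n - v⟫) F (𝓝 ⟪x - y, u₀ - v⟫) :=
        tendsto_inner_of_weak_of_strong (hB1 y)
          (fun z => by simpa only [inner_sub_left] using (hx z).sub_const _)
          ((hg.mono_left hF).sub_const v)
      have h2 := ge_of_tendsto' h1 fun n => hQ.1 _ _ _ _ (hQw n) hyv
      rwa [← neg_sub y, ← neg_sub v, inner_neg_neg] at h2
    · have h1 : Tendsto (fun n => ⟪s n - y, M n (w n - s n) - g n - e n - v⟫ - ⟪s n, N y⟫) F
          (𝓝 (⟪x - y, -u₀ - v⟫ - ⟪x, N y⟫)) :=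
        (tendsto_inner_of_weak_of_strong (hB2 y)
          (fun z => by simpa only [inner_sub_left] using (hsx z).sub_const _)
          ((hout.mono_left hF).sub_const v)).sub (hsx _)
      have h2 : 0 ≤ ⟪x - y, -u₀ - v⟫ - ⟪x, N y⟫ := by
        refine ge_of_tendsto' h1 fun n => ?_
        have h3 := hT.1 _ _ _ _ (hTs n) hyv
        have h4 : ⟪s n - y, N (s n)⟫ = ⟪s n, N y⟫ := by
          rw [inner_sub_left, hskew, ← neg_eq_iff_eq_neg.2 (hN y (s n)), real_inner_comm]
          ring
        rw [sub_right_comm, inner_sub_right, h4] at h3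
        exact h3
      have h5 : ⟪y - x, v - (-u₀ - N x)⟫ = ⟪x - y, -u₀ - v⟫ - ⟪x, N y⟫ := by
        have h6 : ⟪y, N x⟫ = -⟪x, N y⟫ := by
          rw [← neg_eq_iff_eq_neg.2 (hN y x), real_inner_comm]
        have h7 := hskew x
        simp only [inner_sub_left, inner_sub_right, inner_neg_right]
        linarith
      rwa [h5]
  -- Weak cluster points are unique.
  have hunique : ∀ (F₁ F₂ : Ultrafilter ℕ) x₁ x₂, ↑F₁ ≤ (atTop : Filter ℕ) →
      ↑F₂ ≤ (atTop : Filter ℕ) → (∀ y, Tendsto (fun n => ⟪w n, y⟫) F₁ (𝓝 ⟪x₁, y⟫)) →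
      (∀ y, Tendsto (fun n => ⟪w n, y⟫) F₂ (𝓝 ⟪x₂, y⟫)) → x₁ = x₂ := by
    intro F₁ F₂ x₁ x₂ hF₁ hF₂ hx₁ hx₂
    obtain ⟨l₁, hl₁⟩ := hYlim x₁ u₀ (hcluster F₁ x₁ hF₁ hx₁).1 (hcluster F₁ x₁ hF₁ hx₁).2
    obtain ⟨l₂, hl₂⟩ := hYlim x₂ u₀ (hcluster F₂ x₂ hF₂ hx₂).1 (hcluster F₂ x₂ hF₂ hx₂).2
    have hMlim := exists_tendsto_of_antitone_inner hs h0 hantitone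
    obtain ⟨a₁, ha₁⟩ := hMlim x₁
    obtain ⟨a₂, ha₂⟩ := hMlim x₂
    have h1 : ∃ l, Tendsto (fun n => ⟪w n, M n (x₁ - x₂)⟫) atTop (𝓝 l) := by
      have h2 := ((((hl₂.pow 2).sub (hl₁.pow 2)).add (ha₁.inner tendsto_const_nhds (𝕜 := ℝ)
        (y := x₁))).sub (ha₂.inner tendsto_const_nhds (𝕜 := ℝ) (y := x₂))).const_mul (1 / 2)
      refine ⟨_, h2.congr fun n => ?_⟩
      rw [Real.sq_sqrt (h0 n _), Real.sq_sqrt (h0 n _)]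
      have h3 : ∀ y, ⟪M n y, w n⟫ = ⟪M n (w n), y⟫ := fun y => by rw [hs, real_inner_comm]
      have h4 : ∀ y, ⟪w n, M n y⟫ = ⟪M n (w n), y⟫ := fun y => by rw [hs]
      simp only [map_sub, inner_sub_left, inner_sub_right, h3, h4]
      ring
    obtain ⟨l, hl⟩ := h1
    have ha : Tendsto (fun n => M n (x₁ - x₂)) atTop (𝓝 (a₁ - a₂)) := by
      simpa only [map_sub] using ha₁.sub ha₂
    have h2 := tendsto_nhds_unique (hl.mono_left hF₁)
      (tendsto_inner_of_weak_of_strong hB hx₁ (ha.mono_left hF₁))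
    have h3 := tendsto_nhds_unique (hl.mono_left hF₂)
      (tendsto_inner_of_weak_of_strong hB hx₂ (ha.mono_left hF₂))
    have h4 : ρ * ‖x₁ - x₂‖ ^ 2 ≤ ⟪a₁ - a₂, x₁ - x₂⟫ :=
      ge_of_tendsto' (ha.inner tendsto_const_nhds) fun n => hM n _
    have h5 : ⟪a₁ - a₂, x₁ - x₂⟫ = 0 := by
      rw [real_inner_comm, inner_sub_left, ← h2, ← h3, sub_self]
    rw [h5] at h4
    have h6 : ‖x₁ - x₂‖ ^ 2 ≤ 0 := by
      by_contra! h7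
      linarith [mul_pos hρ h7]
    have h7 := pow_eq_zero_iff two_ne_zero |>.1 (h6.antisymm (by positivity))
    exact sub_eq_zero.1 (norm_eq_zero.1 h7)
  have hF₀ : ↑(hyperfilter ℕ) ≤ (atTop : Filter ℕ) := Nat.hyperfilter_le_atTop
  obtain ⟨x, hx⟩ := exists_weak_limit_along_ultrafilter hB (hyperfilter ℕ)
  refine ⟨x, u₀, (hcluster _ x hF₀ hx).1, (hcluster _ x hF₀ hx).2, fun y => ?_⟩
  rw [tendsto_iff_ultrafilter]
  intro F hF
  obtain ⟨x', hx'⟩ := exists_weak_limit_along_ultrafilter hB F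
  rw [hunique _ F x x' hF₀ hF hx hx']
  exact hx' y

end VariableMetric

namespace IsMaxMonotone

variable {E F : Type*} [NormedAddCommGroup E] [InnerProductSpace ℝ E]
  [NormedAddCommGroup F] [InnerProductSpace ℝ F]

theorem exists_inner_nonpos {T : E → E → Prop} (hT : IsMaxMonotone T) (y v : E) :
    ∃ x u, T x u ∧ ⟪x - y, u - v⟫ ≤ 0 := by
  by_contra! h
  have := h y v (hT.2 y v fun x u hxu => (h x u hxu).le)
  simp at this

theorem inverse {T : E → E → Prop} (hT : IsMaxMonotone T) : IsMaxMonotone fun x u => T u x :=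
  ⟨fun x y u v hx hy => by rw [real_inner_comm]; exact hT.1 _ _ _ _ hx hy,
    fun y v h => hT.2 _ _ fun x u hxu => by rw [real_inner_comm]; exact h _ _ hxu⟩

theorem add_const {T : E → E → Prop} (hT : IsMaxMonotone T) (z : E) :
    IsMaxMonotone fun x u => T x (u + z) :=
  ⟨fun x y u v hx hy => by simpa using hT.1 _ _ _ _ hx hy,
    fun y v h => hT.2 _ _ fun x u hxu => by
      have := h x (u - z) (by simpa using hxu)
      rwa [sub_sub, add_comm z] at this⟩

theorem prod {T₁ : E → E → Prop} {T₂ : F → F → Prop} (h₁ : IsMaxMonotone T₁)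
    (h₂ : IsMaxMonotone T₂) :
    IsMaxMonotone fun x u : WithLp 2 (E × F) => T₁ x.fst u.fst ∧ T₂ x.snd u.snd := by
  refine ⟨fun x y u v hx hy => ?_, fun y v h => ⟨h₁.2 _ _ fun x u hxu => ?_,
    h₂.2 _ _ fun x u hxu => ?_⟩⟩
  · exact add_nonneg (h₁.1 _ _ _ _ hx.1 hy.1) (h₂.1 _ _ _ _ hx.2 hy.2)
  · obtain ⟨x', u', hxu', hle⟩ := h₂.exists_inner_nonpos y.snd v.snd
    have : 0 ≤ ⟪x - y.fst, u - v.fst⟫ + ⟪x' - y.snd, u' - v.snd⟫ :=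
      h (WithLp.toLp 2 (x, x')) (WithLp.toLp 2 (u, u')) ⟨hxu, hxu'⟩
    linarith
  · obtain ⟨x', u', hxu', hle⟩ := h₁.exists_inner_nonpos y.fst v.fst
    have : 0 ≤ ⟪x' - y.fst, u' - v.fst⟫ + ⟪x - y.snd, u - v.snd⟫ :=
      h (WithLp.toLp 2 (x', x)) (WithLp.toLp 2 (u', u)) ⟨hxu', hxu⟩
    linarith

theorem pi {ι : Type*} [Fintype ι] {G : ι → Type*} [∀ i, NormedAddCommGroup (G i)]
    [∀ i, InnerProductSpace ℝ (G i)] {T : ∀ i, G i → G i → Prop}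
    (hT : ∀ i, IsMaxMonotone (T i)) :
    IsMaxMonotone fun x u : PiLp 2 G => ∀ i, T i (x i) (u i) := by
  classical
  refine ⟨fun x y u v hx hy => ?_, fun y v h i => (hT i).2 _ _ fun x u hxu => ?_⟩
  · rw [PiLp.inner_apply]
    exact Finset.sum_nonneg fun i _ => (hT i).1 _ _ _ _ (hx i) (hy i)
  · choose x' u' hxu' hle using fun j => (hT j).exists_inner_nonpos (y j) (v j)
    have h1 := h (WithLp.toLp 2 (Function.update x' i x)) (WithLp.toLp 2 (Function.update u' i u))
      fun j => by
        rcases eq_or_ne j i with rfl | hj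
        · simpa using hxu
        · simpa [hj] using hxu' j
    rw [PiLp.inner_apply, ← Finset.add_sum_erase _ _ (Finset.mem_univ i)] at h1
    have h2 : ∑ j ∈ Finset.univ.erase i,
        ⟪(WithLp.toLp 2 (Function.update x' i x) - y : PiLp 2 G) j,
          (WithLp.toLp 2 (Function.update u' i u) - v : PiLp 2 G) j⟫ ≤ 0 :=
      Finset.sum_nonpos fun j hj => by
        simpa [Finset.ne_of_mem_erase hj] using hle j
    simp only [PiLp.sub_apply, Function.update_self] at h1 h2
    linarith

theorem of_cocoercive {C : E → E} {μ : ℝ} (hμ : 0 < μ)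
    (hC : ∀ x y, ⟪x - y, C x - C y⟫ ≥ μ * ‖C x - C y‖ ^ 2) :
    IsMaxMonotone fun x u => u = C x := by
  refine ⟨fun x y u v hu hv => ?_, fun y v h => ?_⟩
  · subst hu hv
    exact le_trans (by positivity) (hC x y)
  · have hlip : ∀ x y, ‖C x - C y‖ ≤ μ⁻¹ * ‖x - y‖ := fun x y => by
      rw [inv_mul_eq_div, le_div_iff₀ hμ]
      by_contra! hlt
      have h1 := real_inner_le_norm (x - y) (C x - C y)
      have h2 : 0 < ‖C x - C y‖ := by
        by_contra! h3
        nlinarith [norm_nonneg (x - y)]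
      nlinarith [hC x y]
    have hcont : Continuous C :=
      (LipschitzWith.of_dist_le_mul (K := ⟨μ⁻¹, by positivity⟩) fun x y => by
        rw [dist_eq_norm, dist_eq_norm]
        exact hlip x y).continuous
    have hcurve : Tendsto (fun t : ℝ => ⟪v - C y, C (y + t • (v - C y)) - v⟫) (𝓝[>] 0)
        (𝓝 ⟪v - C y, C y - v⟫) := by
      have h1 : Continuous fun t : ℝ => ⟪v - C y, C (y + t • (v - C y)) - v⟫ := by fun_prop
      simpa using (h1.tendsto 0).mono_left nhdsWithin_le_nhds
    have hnonneg := ge_of_tendsto hcurve (b := 0) <| by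
      filter_upwards [self_mem_nhdsWithin] with t ht
      have h1 := h (y + t • (v - C y)) _ rfl
      rw [add_sub_cancel_left, real_inner_smul_left] at h1
      exact nonneg_of_mul_nonneg_right h1 ht
    rw [← neg_sub v, inner_neg_right, real_inner_self_eq_norm_sq] at hnonneg
    have h1 : ‖v - C y‖ ^ 2 = 0 := le_antisymm (by linarith) (by positivity)
    exact sub_eq_zero.1 (norm_eq_zero.1 (pow_eq_zero_iff two_ne_zero |>.1 h1))

end IsMaxMonotone

section Inverse

variable {E : Type*} [NormedAddCommGroup E] [InnerProductSpace ℝ E]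

theorem exists_inverse_of_coercive [CompleteSpace E] {U : E →L[ℝ] E} {α : ℝ} (hα : 0 < α)
    (hU : ∀ x, ⟪U x, x⟫ ≥ α * ‖x‖ ^ 2) :
    ∃ V : E →L[ℝ] E, (∀ x, U (V x) = x) ∧ ∀ x, V (U x) = x := by
  obtain ⟨u, hu⟩ := ContinuousLinearMap.isUnit_of_forall_le_norm_inner_map U
    (c := ⟨α, hα.le⟩) hα fun x => by
      rw [mul_comm]
      exact (hU x).le.trans (Real.le_norm_self _)
  refine ⟨(u⁻¹ : (E →L[ℝ] E)ˣ), fun x => ?_, fun x => ?_⟩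
  · rw [← hu]
    exact DFunLike.congr_fun u.mul_inv x
  · rw [← hu]
    exact DFunLike.congr_fun u.inv_mul x

theorem inner_inverse_comm {U V : E → E} (hs : ∀ u v, ⟪U u, v⟫ = ⟪u, U v⟫)
    (hUV : ∀ x, U (V x) = x) (u v : E) : ⟪V u, v⟫ = ⟪u, V v⟫ := by
  conv_lhs => rw [← hUV v]
  rw [← hs, hUV]

/-- Inversion reverses the order of positive symmetric operators. -/
theorem inner_inverse_antitone {U U' V V' : E →L[ℝ] E} (hs : ∀ u v, ⟪U u, v⟫ = ⟪u, U v⟫)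
    (h0 : ∀ u, 0 ≤ ⟪U u, u⟫) (hle : ∀ u, ⟪U u, u⟫ ≤ ⟪U' u, u⟫) (hUV : ∀ x, U (V x) = x)
    (hUV' : ∀ x, U' (V' x) = x) (x : E) : ⟪V' x, x⟫ ≤ ⟪V x, x⟫ := by
  have h1 := h0 (V' x - V x)
  have h2 := hle (V' x)
  have h3 : ⟪U (V' x), V x⟫ = ⟪V' x, x⟫ := by rw [hs, hUV]
  rw [hUV'] at h2
  simp only [map_sub, inner_sub_left, inner_sub_right, hUV, h3] at h1
  rw [real_inner_comm (V' x) x] at h2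
  rw [real_inner_comm (V' x) x] at h1
  linarith [real_inner_comm (V x) x, real_inner_comm (V' x) x]

theorem exists_sqrt_preimage {R U V : E →L[ℝ] E} (hR : ∀ u v, ⟪R u, v⟫ = ⟪u, R v⟫)
    (hRU : ∀ x, R (R x) = U x) (hUV : ∀ x, U (V x) = x) (x : E) :
    ∃ ξ, R ξ = x ∧ ‖ξ‖ ^ 2 = ⟪V x, x⟫ ∧ ‖x‖ ^ 2 ≤ ‖U‖ * ‖ξ‖ ^ 2 := by
  have hRξ : R (R (V x)) = x := by rw [hRU, hUV]
  refine ⟨R (V x), hRξ, ?_, ?_⟩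
  · rw [← real_inner_self_eq_norm_sq, hR, hRξ]
  · have h1 : ‖x‖ ^ 2 = ⟪U (R (V x)), R (V x)⟫ := by
      rw [← hRU, hR, hRξ, real_inner_self_eq_norm_sq]
    rw [h1]
    refine (real_inner_le_norm _ _).trans ?_
    have := U.le_opNorm (R (V x))
    nlinarith [norm_nonneg (R (V x))]

end Inverse

theorem ext_fst_snd {H ι : Type*} {G : ι → Type*} {u v : WithLp 2 (H × PiLp 2 G)}
    (h₁ : u.fst = v.fst) (h₂ : ∀ i, u.snd i = v.snd i) : u = v :=
  WithLp.ofLp_injective 2 (Prod.ext h₁ (PiLp.ext h₂))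

section PrimalDual

variable {H : Type*} [NormedAddCommGroup H] [InnerProductSpace ℝ H]
  {ι : Type*} [Fintype ι] {G : ι → Type*} [∀ i, NormedAddCommGroup (G i)]
  [∀ i, InnerProductSpace ℝ (G i)]

theorem inner_eq_fst_add_sum (u v : WithLp 2 (H × PiLp 2 G)) :
    ⟪u, v⟫ = ⟪u.fst, v.fst⟫ + ∑ i, ⟪u.snd i, v.snd i⟫ := by
  rw [← PiLp.inner_apply]
  rfl

theorem norm_sq_eq_fst_add_sum (u : WithLp 2 (H × PiLp 2 G)) :
    ‖u‖ ^ 2 = ‖u.fst‖ ^ 2 + ∑ i, ‖u.snd i‖ ^ 2 := by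
  simp only [← real_inner_self_eq_norm_sq, inner_eq_fst_add_sum]

theorem norm_le_fst_add_sum (u : WithLp 2 (H × PiLp 2 G)) :
    ‖u‖ ≤ ‖u.fst‖ + ∑ i, ‖u.snd i‖ := by
  have h1 : 0 ≤ ∑ i, ‖u.snd i‖ := Finset.sum_nonneg fun i _ => norm_nonneg _
  refine le_of_sq_le_sq ?_ (by positivity)
  have h2 : ∑ i, ‖u.snd i‖ ^ 2 ≤ (∑ i, ‖u.snd i‖) ^ 2 :=
    Finset.sum_sq_le_sq_sum_of_nonneg fun i _ => norm_nonneg _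
  rw [norm_sq_eq_fst_add_sum]
  nlinarith [norm_nonneg u.fst]

variable [CompleteSpace H] [∀ i, CompleteSpace (G i)]

/-- The block operator `(x, v) ↦ (V x - ∑ L i* (v i), W i (v i) - L i x)`. -/
noncomputable def primalDualMetric (V : H →L[ℝ] H) (W : ∀ i, G i →L[ℝ] G i)
    (L : ∀ i, H →L[ℝ] G i) : WithLp 2 (H × PiLp 2 G) →L[ℝ] WithLp 2 (H × PiLp 2 G) where
  toFun u := WithLp.toLp 2 (V u.fst - ∑ i, (ContinuousLinearMap.adjoint (L i)) (u.snd i),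
    WithLp.toLp 2 fun i => W i (u.snd i) - L i u.fst)
  map_add' u v := by
    refine ext_fst_snd ?_ fun i => ?_
    · simp [Finset.sum_add_distrib]; abel
    · simp; abel
  map_smul' t u := by
    refine ext_fst_snd ?_ fun i => ?_
    · simp [Finset.smul_sum, smul_sub]
    · simp [smul_sub]
  cont := by fun_prop

/-- The skew operator `(x, v) ↦ (∑ L i* (v i), -L i x)`. -/
noncomputable def primalDualSkew (L : ∀ i, H →L[ℝ] G i) :
    WithLp 2 (H × PiLp 2 G) →ₗ[ℝ] WithLp 2 (H × PiLp 2 G) where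
  toFun u := WithLp.toLp 2 (∑ i, (ContinuousLinearMap.adjoint (L i)) (u.snd i),
    WithLp.toLp 2 fun i => -L i u.fst)
  map_add' u v := by
    refine ext_fst_snd ?_ fun i => ?_
    · simp [Finset.sum_add_distrib]
    · simp; abel
  map_smul' t u := by
    refine ext_fst_snd ?_ fun i => ?_
    · simp [Finset.smul_sum]
    · simp

theorem primalDualSkew_fst (L : ∀ i, H →L[ℝ] G i) (u : WithLp 2 (H × PiLp 2 G)) :
    (primalDualSkew L u).fst = ∑ i, (ContinuousLinearMap.adjoint (L i)) (u.snd i) := rfl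

theorem primalDualSkew_snd (L : ∀ i, H →L[ℝ] G i) (u : WithLp 2 (H × PiLp 2 G)) (i : ι) :
    (primalDualSkew L u).snd i = -L i u.fst := rfl

theorem inner_primalDualSkew (L : ∀ i, H →L[ℝ] G i) (u v : WithLp 2 (H × PiLp 2 G)) :
    ⟪primalDualSkew L u, v⟫ = -⟪u, primalDualSkew L v⟫ := by
  simp only [inner_eq_fst_add_sum, primalDualSkew_fst, primalDualSkew_snd,
    sum_inner, inner_sum, ContinuousLinearMap.adjoint_inner_left,
    ContinuousLinearMap.adjoint_inner_right, inner_neg_left, inner_neg_right,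
    Finset.sum_neg_distrib]
  ring

variable {V : H →L[ℝ] H} {W : ∀ i, G i →L[ℝ] G i} {L : ∀ i, H →L[ℝ] G i}

theorem primalDualMetric_fst (u : WithLp 2 (H × PiLp 2 G)) : (primalDualMetric V W L u).fst =
    V u.fst - ∑ i, (ContinuousLinearMap.adjoint (L i)) (u.snd i) := rfl

theorem primalDualMetric_snd (u : WithLp 2 (H × PiLp 2 G)) (i : ι) :
    (primalDualMetric V W L u).snd i = W i (u.snd i) - L i u.fst := rfl

theorem inner_primalDualMetric_comm (hV : ∀ u v, ⟪V u, v⟫ = ⟪u, V v⟫)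
    (hW : ∀ i u v, ⟪W i u, v⟫ = ⟪u, W i v⟫) (u v : WithLp 2 (H × PiLp 2 G)) :
    ⟪primalDualMetric V W L u, v⟫ = ⟪u, primalDualMetric V W L v⟫ := by
  simp only [inner_eq_fst_add_sum, primalDualMetric_fst, primalDualMetric_snd,
    sum_inner, inner_sum, ContinuousLinearMap.adjoint_inner_left,
    ContinuousLinearMap.adjoint_inner_right, inner_sub_left, inner_sub_right,
    Finset.sum_sub_distrib, hV, hW]
  ring

theorem inner_primalDualMetric_self (u : WithLp 2 (H × PiLp 2 G)) :
    ⟪primalDualMetric V W L u, u⟫ = ⟪V u.fst, u.fst⟫ + ∑ i, ⟪W i (u.snd i), u.snd i⟫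
      - 2 * ∑ i, ⟪L i u.fst, u.snd i⟫ := by
  simp only [inner_eq_fst_add_sum, primalDualMetric_fst, primalDualMetric_snd,
    sum_inner, ContinuousLinearMap.adjoint_inner_left, inner_sub_left,
    Finset.sum_sub_distrib, real_inner_comm (L _ _)]
  ring

theorem primalDualMetric_coercive {U R : H →L[ℝ] H} {Uop S : ∀ i, G i →L[ℝ] G i}
    (hR : ∀ u v, ⟪R u, v⟫ = ⟪u, R v⟫) (hRU : ∀ x, R (R x) = U x) (hUV : ∀ x, U (V x) = x)
    (hS : ∀ i u v, ⟪S i u, v⟫ = ⟪u, S i v⟫) (hSU : ∀ i x, S i (S i x) = Uop i x)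
    (hUW : ∀ i x, Uop i (W i x) = x) {δ ρ : ℝ} (hρ : 0 < ρ)
    (hδ : δ = 1 / √(∑ i, ‖(S i).comp ((L i).comp R)‖ ^ 2) - 1)
    (hcond : δ / ((1 + δ) * max ‖U‖ (⨆ i, ‖Uop i‖)) ≥ ρ) (u : WithLp 2 (H × PiLp 2 G)) :
    ρ * ‖u‖ ^ 2 ≤ ⟪primalDualMetric V W L u, u⟫ := by
  set τ := √(∑ i, ‖(S i).comp ((L i).comp R)‖ ^ 2) with hτ
  set k := max ‖U‖ (⨆ i, ‖Uop i‖) with hk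
  have hτ0 : 0 < τ := by
    refine (Real.sqrt_nonneg _).lt_of_ne fun h => ?_
    rw [← hτ] at h
    rw [hδ, ← h] at hcond
    norm_num at hcond
    linarith
  have hk0 : 0 < k := by
    refine ((norm_nonneg U).trans (le_max_left _ _)).lt_of_ne fun h => ?_
    rw [← hk] at h
    rw [← h] at hcond
    norm_num at hcond
    linarith
  have hρk : ρ * k ≤ 1 - τ := by
    have h1 : δ / ((1 + δ) * k) = (1 - τ) / k := by
      rw [hδ]
      field_simp
      ring
    rwa [h1, ge_iff_le, le_div_iff₀ hk0] at hcond
  obtain ⟨ξ, hξ, hξV, hξU⟩ := exists_sqrt_preimage hR hRU hUV u.fst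
  choose ζ hζ hζW hζU using fun i => exists_sqrt_preimage (hS i) (hSU i) (hUW i) (u.snd i)
  have hUk : ∀ i, ‖Uop i‖ ≤ k := fun i =>
    (le_ciSup (f := fun i => ‖Uop i‖) (Set.finite_range _).bddAbove i).trans (le_max_right _ _)
  have hsum0 : 0 ≤ ∑ i, ‖ζ i‖ ^ 2 := Finset.sum_nonneg fun i _ => sq_nonneg _
  have hcross : ∑ i, ⟪L i u.fst, u.snd i⟫ ≤ ‖ξ‖ * (τ * √(∑ i, ‖ζ i‖ ^ 2)) := by
    refine le_trans ?_ (mul_le_mul_of_nonneg_left (Real.sum_mul_le_sqrt_mul_sqrt Finset.univ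
      (fun i => ‖(S i).comp ((L i).comp R)‖) fun i => ‖ζ i‖) (norm_nonneg ξ))
    rw [Finset.mul_sum]
    refine Finset.sum_le_sum fun i _ => ?_
    rw [← hζ i, ← hS, ← hξ]
    refine (real_inner_le_norm _ _).trans ?_
    have := ((S i).comp ((L i).comp R)).le_opNorm ξ
    calc ‖S i (L i (R ξ))‖ * ‖ζ i‖ ≤ (‖(S i).comp ((L i).comp R)‖ * ‖ξ‖) * ‖ζ i‖ := by
          gcongr
          exact this
      _ = _ := by ring
  have hcross' : 2 * ∑ i, ⟪L i u.fst, u.snd i⟫ ≤ τ * (‖ξ‖ ^ 2 + ∑ i, ‖ζ i‖ ^ 2) := by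
    have h1 := two_mul_le_add_sq ‖ξ‖ √(∑ i, ‖ζ i‖ ^ 2)
    rw [Real.sq_sqrt hsum0] at h1
    nlinarith
  have hnorm : ‖u‖ ^ 2 ≤ k * (‖ξ‖ ^ 2 + ∑ i, ‖ζ i‖ ^ 2) := by
    rw [norm_sq_eq_fst_add_sum, mul_add, Finset.mul_sum]
    refine add_le_add (hξU.trans ?_) (Finset.sum_le_sum fun i _ => (hζU i).trans ?_)
    · gcongr
      exact le_max_left _ _
    · gcongr
      exact hUk i
  rw [inner_primalDualMetric_self, ← hξV]
  simp only [← hζW]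
  calc ρ * ‖u‖ ^ 2 ≤ ρ * (k * (‖ξ‖ ^ 2 + ∑ i, ‖ζ i‖ ^ 2)) := by gcongr
    _ = (ρ * k) * (‖ξ‖ ^ 2 + ∑ i, ‖ζ i‖ ^ 2) := by ring
    _ ≤ (1 - τ) * (‖ξ‖ ^ 2 + ∑ i, ‖ζ i‖ ^ 2) := by gcongr
    _ ≤ _ := by linarith

end PrimalDual

/-- **Variable metric primal–dual algorithm for cocoercive composite inclusions:
weak convergence.** Under the cocoercive composite setup with its range condition and
the variable metric primal–dual iteration, the primal iterates converge weakly to a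
primal solution and the dual iterates converge weakly to a dual solution. -/
theorem cocoercive_primal_dual_weak
    {H : Type*} [NormedAddCommGroup H] [InnerProductSpace ℝ H] [CompleteSpace H]
    {m : ℕ} (hm : 0 < m)
    (G : Fin m → Type*) [∀ i, NormedAddCommGroup (G i)] [∀ i, InnerProductSpace ℝ (G i)]
    [∀ i, CompleteSpace (G i)]
    (z : H)
    (A : H → Set H)
    (hAmono : ∀ x y u v : H, u ∈ A x → v ∈ A y → ⟪x - y, u - v⟫ ≥ 0)
    (hAmax : ∀ y v : H, (∀ x u : H, u ∈ A x → ⟪x - y, u - v⟫ ≥ 0) → v ∈ A y)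
    (μc : ℝ) (hμc : 0 < μc)
    (C : H → H)
    (hC : ∀ x y : H, ⟪x - y, C x - C y⟫ ≥ μc * ‖C x - C y‖ ^ 2)
    (r : ∀ i, G i)
    (Bop : ∀ i, G i → Set (G i))
    (hBmono : ∀ i, ∀ x y u v : G i, u ∈ Bop i x → v ∈ Bop i y → ⟪x - y, u - v⟫ ≥ 0)
    (hBmax : ∀ i, ∀ y v : G i, (∀ x u : G i, u ∈ Bop i x → ⟪x - y, u - v⟫ ≥ 0) → v ∈ Bop i y)
    (ν : Fin m → ℝ) (hν : ∀ i, 0 < ν i)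
    (D : ∀ i, G i → Set (G i))
    (hDstrong : ∀ i, ∀ x y u v : G i, u ∈ D i x → v ∈ D i y →
      ⟪x - y, u - v⟫ ≥ ν i * ‖x - y‖ ^ 2)
    (hDmax : ∀ i, ∀ y v : G i, (∀ x u : G i, u ∈ D i x → ⟪x - y, u - v⟫ ≥ 0) → v ∈ D i y)
    (L : ∀ i, H →L[ℝ] G i) (hL : ∀ i, L i ≠ 0)
    (PrimalSol : H → Prop)
    (hPrimal : ∀ xb : H, PrimalSol xb ↔
      ∃ a ∈ A xb, ∃ w : (i : Fin m) → G i,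
        (∀ i, ∃ pp qq : G i, w i ∈ Bop i pp ∧ w i ∈ D i qq ∧ L i xb - r i = pp + qq) ∧
        z = a + ∑ i, (ContinuousLinearMap.adjoint (L i)) (w i) + C xb)
    (hrange : ∃ xb : H, PrimalSol xb)
    (DualSol : ((i : Fin m) → G i) → Prop)
    (hDualSol : ∀ v : (i : Fin m) → G i, DualSol v ↔
      ∃ x : H, (z - ∑ j, (ContinuousLinearMap.adjoint (L j)) (v j) - C x ∈ A x) ∧
        ∀ i, ∃ pp qq : G i, v i ∈ Bop i pp ∧ v i ∈ D i qq ∧ L i x - r i = pp + qq)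
    (β : ℝ) (hβ : β = min μc (⨅ i, ν i))
    (ε : ℝ) (hε : ε ∈ Set.Ioo 0 (min 1 β))
    (α : ℝ) (hα : 0 < α)
    (lam : ℕ → ℝ) (hlam : ∀ n, lam n ∈ Set.Icc ε 1)
    (a c : ℕ → H) (ha : Summable fun n => ‖a n‖) (hc : Summable fun n => ‖c n‖)
    (U : ℕ → H →L[ℝ] H) (hUsa : ∀ n, IsSelfAdjoint (U n))
    (hUα : ∀ n (x : H), ⟪U n x, x⟫ ≥ α * ‖x‖ ^ 2)
    (hUmono : ∀ n (x : H), ⟪U (n + 1) x, x⟫ ≥ ⟪U n x, x⟫)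
    (b d : ∀ i, ℕ → G i)
    (hb : ∀ i, Summable fun n => ‖b i n‖) (hd : ∀ i, Summable fun n => ‖d i n‖)
    (Uop : ∀ i, ℕ → (G i →L[ℝ] G i))
    (hUopsa : ∀ i n, IsSelfAdjoint (Uop i n))
    (hUopα : ∀ i n (v : G i), ⟪Uop i n v, v⟫ ≥ α * ‖v‖ ^ 2)
    (hUopmono : ∀ i n (v : G i), ⟪Uop i (n + 1) v, v⟫ ≥ ⟪Uop i n v, v⟫)
    (R : ℕ → H →L[ℝ] H)
    (hRsa : ∀ n, IsSelfAdjoint (R n)) (hRpos : ∀ n (x : H), ⟪R n x, x⟫ ≥ 0)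
    (hRsq : ∀ n, (R n).comp (R n) = U n)
    (S : ∀ i, ℕ → (G i →L[ℝ] G i))
    (hSsa : ∀ i n, IsSelfAdjoint (S i n)) (hSpos : ∀ i n (v : G i), ⟪S i n v, v⟫ ≥ 0)
    (hSsq : ∀ i n, (S i n).comp (S i n) = Uop i n)
    (δ : ℕ → ℝ)
    (hδ : ∀ n, δ n = 1 / Real.sqrt (∑ i, ‖(S i n).comp ((L i).comp (R n))‖ ^ 2) - 1)
    (hcond : ∀ n,
      δ n / ((1 + δ n) * max ‖U n‖ (⨆ i, ‖Uop i n‖)) ≥ 1 / (2 * β - ε))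
    (x p π y : ℕ → H) (v q t κ : ∀ i, ℕ → G i)
    (hπ : ∀ n, (x n - U n ((∑ i, (ContinuousLinearMap.adjoint (L i)) (v i n)) +
        C (x n) + c n - z)) - π n ∈ (fun u => U n u) '' A (π n))
    (hpdef : ∀ n, p n = π n + a n)
    (hydef : ∀ n, y n = (2 : ℝ) • p n - x n)
    (hxrec : ∀ n, x (n + 1) = x n + lam n • (p n - x n))
    (ht : ∀ i n, v i n ∈ D i (t i n))
    (hκ : ∀ i n, ∃ u : G i, κ i n ∈ Bop i u ∧
      (v i n + Uop i n (L i (y n) - t i n - d i n - r i)) - κ i n = Uop i n u)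
    (hq : ∀ i n, q i n = κ i n + b i n)
    (hvrec : ∀ i n, v i (n + 1) = v i n + lam n • (q i n - v i n)) :
    ∃ (xb : H) (vb : (i : Fin m) → G i), PrimalSol xb ∧ DualSol vb ∧
      (∀ w : H, Tendsto (fun n => ⟪x n, w⟫) atTop (𝓝 ⟪xb, w⟫)) ∧
      (∀ i, ∀ w' : G i, Tendsto (fun n => ⟪v i n, w'⟫) atTop (𝓝 ⟪vb i, w'⟫)) := by
  have hβμ : β ≤ μc := hβ ▸ min_le_left _ _
  have hβν : ∀ i, β ≤ ν i := fun i =>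
    hβ ▸ (min_le_right _ _).trans (ciInf_le (Set.finite_range ν).bddBelow i)
  have hε0 : 0 < ε := hε.1
  have hεβ : ε < β := hε.2.trans_le (min_le_right _ _)
  have hβ0 : 0 < β := hε0.trans hεβ
  have hden : 0 < 2 * β - ε := by linarith
  have hρ : 0 < 1 / (2 * β - ε) := by positivity
  have hUs : ∀ n u u', ⟪U n u, u'⟫ = ⟪u, U n u'⟫ := fun n => (hUsa n).isSymmetric
  have hUops : ∀ i n u u', ⟪Uop i n u, u'⟫ = ⟪u, Uop i n u'⟫ := fun i n => (hUopsa i n).isSymmetric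
  choose V hUV hVU using fun n => exists_inverse_of_coercive hα (hUα n)
  choose W hUW hWU using fun i n => exists_inverse_of_coercive hα (hUopα i n)
  have hA : IsMaxMonotone fun x u => u ∈ A x := ⟨hAmono, hAmax⟩
  have hB : ∀ i, IsMaxMonotone fun x u => u ∈ Bop i x := fun i => ⟨hBmono i, hBmax i⟩
  have hD : ∀ i, IsMaxMonotone fun x u => u ∈ D i x := fun i =>
    ⟨fun x y u u' hu hu' => le_trans (mul_nonneg (hν i).le (sq_nonneg _))
      (hDstrong i x y u u' hu hu'), hDmax i⟩
  have hT := (hA.add_const z).prod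
    (IsMaxMonotone.pi fun i => (hB i).inverse.add_const (-r i))
  have hQ := (IsMaxMonotone.of_cocoercive hμc hC).prod (IsMaxMonotone.pi fun i => (hD i).inverse)
  have hsum : ∀ {f : ∀ i, ℕ → G i}, (∀ i, Summable fun n => ‖f i n‖) →
      ∀ {h : ℕ → H}, (Summable fun n => ‖h n‖) →
      Summable fun n => ‖(WithLp.toLp 2 (h n, WithLp.toLp 2 fun i => f i n) :
        WithLp 2 (H × PiLp 2 G))‖ := fun hf h hh =>
    (hh.add (summable_sum fun i _ => hf i)).of_nonneg_of_le (fun n => norm_nonneg _)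
      fun n => norm_le_fst_add_sum _
  have hconv := variable_metric_forward_backward (ε := ε) (lam := lam) (N := primalDualSkew L)
    (M := fun n => primalDualMetric (V n) (fun i => W i n) L) hT hQ hβ0 ?_
    (inner_primalDualSkew L)
    (fun n => inner_primalDualMetric_comm (inner_inverse_comm (hUs n) (hUV n))
      fun i => inner_inverse_comm (hUops i n) (hUW i n)) ?_ hρ ?_
    (fun n => primalDualMetric_coercive (fun u u' => (hRsa n).isSymmetric u u')
      (fun x => DFunLike.congr_fun (hRsq n) x) (hUV n)
      (fun i u u' => (hSsa i n).isSymmetric u u') (fun i x => DFunLike.congr_fun (hSsq i n) x)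
      (fun i => hUW i n) hρ (hδ n) (hcond n)) hε0 hlam
    (w := fun n => WithLp.toLp 2 (x n, WithLp.toLp 2 fun i => v i n))
    (s := fun n => WithLp.toLp 2 (π n, WithLp.toLp 2 fun i => κ i n))
    (g := fun n => WithLp.toLp 2 (C (x n), WithLp.toLp 2 fun i => t i n))
    (e := fun n => WithLp.toLp 2 (c n, WithLp.toLp 2 fun i => d i n - L i ((2 : ℝ) • a n)))
    (f := fun n => WithLp.toLp 2 (a n, WithLp.toLp 2 fun i => b i n))
    (hsum (fun i => ?_) hc) (hsum hb ha) (fun n => ⟨?_, fun i => ?_⟩)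
    (fun n => ⟨rfl, fun i => ht i n⟩) (fun n => ext_fst_snd ?_ fun i => ?_) ?_
  · obtain ⟨X, Y, ⟨hY, hXD⟩, ⟨hXA, hXB⟩, hlim⟩ := hconv
    have hsol : ∀ i, ∃ pp qq : G i, X.snd i ∈ Bop i pp ∧ X.snd i ∈ D i qq ∧
        L i X.fst - r i = pp + qq := fun i =>
      ⟨_, _, hXB i, hXD i, by simp [primalDualSkew_snd]; abel⟩
    have hXA' : z - ∑ j, (ContinuousLinearMap.adjoint (L j)) (X.snd j) - C X.fst ∈ A X.fst := by
      convert hXA using 1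
      simp only [WithLp.sub_fst, WithLp.neg_fst, primalDualSkew_fst, hY]
      abel
    refine ⟨X.fst, fun i => X.snd i, (hPrimal _).2 ⟨_, hXA', fun i => X.snd i, hsol, by abel⟩,
      (hDualSol _).2 ⟨X.fst, hXA', hsol⟩, fun u => ?_, fun i u => ?_⟩
    · simpa [inner_eq_fst_add_sum] using hlim (WithLp.toLp 2 (u, 0))
    · classical
      have h1 := hlim (WithLp.toLp 2 (0, WithLp.toLp 2 (Pi.single i u)))
      have h2 : ∀ Z : WithLp 2 (H × PiLp 2 G),
          ⟪Z, WithLp.toLp 2 (0, WithLp.toLp 2 (Pi.single i u))⟫ = ⟪Z.snd i, u⟫ := fun Z => by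
        rw [inner_eq_fst_add_sum, Finset.sum_eq_single i]
        · simp
        · intro j _ hj
          simp [hj]
        · simp
      simp only [h2] at h1
      exact h1
  · intro X Y X' Y' hX hY
    rw [norm_sq_eq_fst_add_sum, inner_eq_fst_add_sum, mul_add, Finset.mul_sum]
    refine add_le_add ?_ (Finset.sum_le_sum fun i _ => ?_)
    · have h1 := hC X.fst Y.fst
      rw [← hX.1, ← hY.1] at h1
      refine le_trans ?_ h1
      exact mul_le_mul_of_nonneg_right hβμ (sq_nonneg _)
    · have h1 := hDstrong i _ _ _ _ (hX.2 i) (hY.2 i)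
      rw [real_inner_comm] at h1
      exact le_trans (mul_le_mul_of_nonneg_right (hβν i) (sq_nonneg _)) h1
  · intro n u
    rw [inner_primalDualMetric_self, inner_primalDualMetric_self]
    refine sub_le_sub_right (add_le_add ?_ (Finset.sum_le_sum fun i _ => ?_)) _
    · exact inner_inverse_antitone (hUs n) (fun u => le_trans (by positivity) (hUα n u))
        (hUmono n) (hUV n) (hUV (n + 1)) _
    · exact inner_inverse_antitone (hUops i n) (fun u => le_trans (by positivity) (hUopα i n u))
        (hUopmono i n) (hUW i n) (hUW i (n + 1)) _
  · rw [mul_one_div, lt_div_iff₀ hden]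
    linarith
  · refine ((hd i).add (ha.mul_left (‖L i‖ * 2))).of_nonneg_of_le (fun n => norm_nonneg _)
      fun n => (norm_sub_le _ _).trans (add_le_add_right ?_ _)
    refine ((L i).le_opNorm _).trans_eq ?_
    rw [norm_smul]
    norm_num
    ring
  · obtain ⟨u, hu, hUu⟩ := hπ n
    have h1 := congrArg (V n) hUu
    simp only [hVU, map_sub] at h1
    have h2 : V n (x n - π n) - ∑ i, (ContinuousLinearMap.adjoint (L i)) (v i n - κ i n) -
        C (x n) - c n - ∑ i, (ContinuousLinearMap.adjoint (L i)) (κ i n) + z = u := by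
      simp only [h1, map_sub, Finset.sum_sub_distrib]
      abel
    exact h2 ▸ hu
  · obtain ⟨u, hu, hUu⟩ := hκ i n
    have h1 := congrArg (W i n) hUu
    simp only [hWU, map_sub, map_add] at h1
    have h2 : W i n (v i n - κ i n) - L i (x n - π n) - t i n - (d i n - L i ((2 : ℝ) • a n)) -
        -L i (π n) + -r i = u := by
      simp only [← h1, hydef, hpdef, map_sub, map_add, map_smul]
      module
    exact h2 ▸ hu
  · change x (n + 1) = x n + lam n • (π n + a n - x n)
    rw [hxrec, hpdef]
  · change v i (n + 1) = v i n + lam n • (κ i n + b i n - v i n)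
    rw [hvrec, hq]
  · obtain ⟨X, hX⟩ := hrange
    obtain ⟨a', ha', w, hw, hz⟩ := (hPrimal X).1 hX
    choose pp qq hpp hqq hpq using hw
    refine ⟨WithLp.toLp 2 (X, WithLp.toLp 2 w), WithLp.toLp 2 (C X, WithLp.toLp 2 qq),
      ⟨rfl, hqq⟩, ?_, fun i => ?_⟩
    · have h1 : -C X - ∑ i, (ContinuousLinearMap.adjoint (L i)) (w i) + z = a' := by
        rw [hz]
        abel
      exact h1 ▸ ha'
    · have h1 : -qq i - -L i X + -r i = pp i := by
        rw [← sub_eq_iff_eq_add.2 (hpq i)]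
        abel
      exact h1 ▸ hpp i
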